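/- Let φ : G → H be a homomorphism of free groups, where G has free basis a₁, …, aₙ, and suppose φ has remnant. Then for every nontrivial z ∈ G with reduced expression z = a_{j₁}^{η₁}·a_{j₂}^{η₂}⋯a_{j_k}^{η_k} (each ηᵢ = ±1, no generator adjacent to its inverse), one has |zφ| ≥ Σᵢ₌₁ᵏ |Rem_φ(a_{jᵢ})|. -/

import Mathlib

/-- The number of letters cancelled in the product `u * v` of elements of a free group:
`c(u,v) = (|u| + |v| - |uv|)/2`. -/
def cancel {κ : Type*} [DecidableEq κ] (u v : FreeGroup κ) : ℕ :=
  (FreeGroup.norm u + FreeGroup.norm v - FreeGroup.norm (u * v)) / 2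

/-- The basis letter indexed by `(i, ε)`: `of i` if `ε = true`, `(of i)⁻¹` if `ε = false`. -/
def bLetter {ι : Type*} (p : ι × Bool) : FreeGroup ι :=
  cond p.2 (FreeGroup.of p.1) (FreeGroup.of p.1)⁻¹

/-- `P_χ(x_i)`: maximal cancellation of `x_iχ` with the image of a basis letter `b ≠ x_i⁻¹`
multiplied on the left. -/
def Pc {ι κ : Type*} [Fintype ι] [DecidableEq ι] [DecidableEq κ]
    (χ : FreeGroup ι →* FreeGroup κ) (i : ι) : ℕ :=
  (Finset.univ.erase (i, false)).sup fun p => cancel (χ (bLetter p)) (χ (FreeGroup.of i))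

/-- `S_χ(x_i)`: maximal cancellation of `x_iχ` with the image of a basis letter `b ≠ x_i⁻¹`
multiplied on the right. -/
def Sc {ι κ : Type*} [Fintype ι] [DecidableEq ι] [DecidableEq κ]
    (χ : FreeGroup ι →* FreeGroup κ) (i : ι) : ℕ :=
  (Finset.univ.erase (i, false)).sup fun p => cancel (χ (FreeGroup.of i)) (χ (bLetter p))

/-- `χ` has remnant if for every basis element a nontrivial subword of its image survives
all the cancellations: `P_χ(x_i) + S_χ(x_i) < |x_iχ|`. -/
def HasRemnant {ι κ : Type*} [Fintype ι] [DecidableEq ι] [DecidableEq κ]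
    (χ : FreeGroup ι →* FreeGroup κ) : Prop :=
  ∀ i : ι, Pc χ i + Sc χ i < FreeGroup.norm (χ (FreeGroup.of i))

/-- The remnant length `|Rem_χ(x_i)| = |x_iχ| - P_χ(x_i) - S_χ(x_i)`. -/
def RemLen {ι κ : Type*} [Fintype ι] [DecidableEq ι] [DecidableEq κ]
    (χ : FreeGroup ι →* FreeGroup κ) (i : ι) : ℕ :=
  FreeGroup.norm (χ (FreeGroup.of i)) - Pc χ i - Sc χ i

namespace FreeGroup

/-- Two reduced words split off a common prefix so that the remaining words meet without
cancellation. -/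
theorem IsReduced.exists_common_prefix {κ : Type*} [DecidableEq κ] :
    ∀ {L₁ L₂ : List (κ × Bool)}, IsReduced L₁ → IsReduced L₂ →
      ∃ c a b, L₁ = c ++ a ∧ L₂ = c ++ b ∧ IsReduced (invRev a ++ b)
  | [], L₂, _, h₂ => ⟨[], [], L₂, rfl, rfl, by simpa using h₂⟩
  | x :: L₁, [], h₁, _ => ⟨[], x :: L₁, [], rfl, rfl, by
      rw [List.append_nil, isReduced_iff_reduce_eq, reduce_invRev, h₁.reduce_eq]⟩
  | x :: L₁, y :: L₂, h₁, h₂ => by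
    by_cases hxy : x = y
    · subst hxy
      obtain ⟨c, a, b, rfl, rfl, h⟩ := exists_common_prefix
        (h₁.infix (List.suffix_cons x L₁).isInfix) (h₂.infix (List.suffix_cons x L₂).isInfix)
      exact ⟨x :: c, a, b, rfl, rfl, h⟩
    · refine ⟨[], x :: L₁, y :: L₂, rfl, rfl, ?_⟩
      have h₁' : IsReduced (invRev (x :: L₁)) := by
        rw [isReduced_iff_reduce_eq, reduce_invRev, h₁.reduce_eq]
      refine List.IsChain.append h₁' h₂ ?_
      obtain ⟨i, ε⟩ := x
      obtain ⟨j, δ⟩ := y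
      cases ε <;> cases δ <;> simp_all [invRev]

end FreeGroup

theorem length_le_cancel {κ : Type*} [DecidableEq κ] {u v : FreeGroup κ}
    {c : List (κ × Bool)} (hu : c <+: u⁻¹.toWord) (hv : c <+: v.toWord) :
    c.length ≤ cancel u v := by
  obtain ⟨a, ha⟩ := hu
  obtain ⟨b, hb⟩ := hv
  have hmul : u * v = (FreeGroup.mk a)⁻¹ * FreeGroup.mk b := by
    have hu' : u⁻¹ = FreeGroup.mk c * FreeGroup.mk a := by
      rw [FreeGroup.mul_mk, ha, FreeGroup.mk_toWord]
    have hv' : v = FreeGroup.mk c * FreeGroup.mk b := by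
      rw [FreeGroup.mul_mk, hb, FreeGroup.mk_toWord]
    rw [← inv_inv u, hu', hv']
    group
  have hnu : FreeGroup.norm u = c.length + a.length := by
    rw [← FreeGroup.norm_inv_eq, FreeGroup.norm, ← ha, List.length_append]
  have hnv : FreeGroup.norm v = c.length + b.length := by
    rw [FreeGroup.norm, ← hb, List.length_append]
  have hle : FreeGroup.norm (u * v) ≤ a.length + b.length := by
    rw [hmul]
    refine (FreeGroup.norm_mul_le _ _).trans (add_le_add ?_ FreeGroup.norm_mk_le)
    rw [FreeGroup.norm_inv_eq]
    exact FreeGroup.norm_mk_le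
  unfold cancel
  omega

theorem exists_prefix_length_eq_cancel {κ : Type*} [DecidableEq κ] (u v : FreeGroup κ) :
    ∃ c, c <+: u⁻¹.toWord ∧ c <+: v.toWord ∧ c.length = cancel u v ∧
      FreeGroup.norm (u * v) + 2 * cancel u v = FreeGroup.norm u + FreeGroup.norm v := by
  obtain ⟨c, a, b, ha, hb, hr⟩ :=
    (FreeGroup.isReduced_toWord (x := u⁻¹)).exists_common_prefix
      (FreeGroup.isReduced_toWord (x := v))
  have hmul : u * v = FreeGroup.mk (FreeGroup.invRev a ++ b) := by
    have hu' : u⁻¹ = FreeGroup.mk c * FreeGroup.mk a := by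
      rw [FreeGroup.mul_mk, ← ha, FreeGroup.mk_toWord]
    have hv' : v = FreeGroup.mk c * FreeGroup.mk b := by
      rw [FreeGroup.mul_mk, ← hb, FreeGroup.mk_toWord]
    rw [← FreeGroup.mul_mk, ← FreeGroup.inv_mk, ← inv_inv u, hu', hv']
    group
  have hnu : FreeGroup.norm u = c.length + a.length := by
    rw [← FreeGroup.norm_inv_eq, FreeGroup.norm, ha, List.length_append]
  have hnv : FreeGroup.norm v = c.length + b.length := by
    rw [FreeGroup.norm, hb, List.length_append]
  have hn : FreeGroup.norm (u * v) = a.length + b.length := by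
    rw [hmul, FreeGroup.norm, FreeGroup.toWord_mk, hr.reduce_eq, List.length_append,
      FreeGroup.invRev_length]
  have hc : c.length = cancel u v := by
    unfold cancel
    omega
  exact ⟨c, ⟨a, ha.symm⟩, ⟨b, hb.symm⟩, hc, by omega⟩

theorem norm_mul_add_two_mul_cancel {κ : Type*} [DecidableEq κ] (u v : FreeGroup κ) :
    FreeGroup.norm (u * v) + 2 * cancel u v = FreeGroup.norm u + FreeGroup.norm v := by
  obtain ⟨-, -, -, -, h⟩ := exists_prefix_length_eq_cancel u v
  exact h

theorem cancel_inv_inv {κ : Type*} [DecidableEq κ] (u v : FreeGroup κ) :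
    cancel v⁻¹ u⁻¹ = cancel u v := by
  unfold cancel
  rw [← mul_inv_rev, FreeGroup.norm_inv_eq, FreeGroup.norm_inv_eq, FreeGroup.norm_inv_eq,
    add_comm (FreeGroup.norm v)]

/-- Cancellation is the Gromov product of a tree, hence an ultrametric-type inequality. -/
theorem min_cancel_le_cancel {κ : Type*} [DecidableEq κ] (x u w : FreeGroup κ) :
    min (cancel x w) (cancel u⁻¹ w) ≤ cancel x u := by
  obtain ⟨c, hcx, hcw, hc, -⟩ := exists_prefix_length_eq_cancel x w
  obtain ⟨d, hdu, hdw, hd, -⟩ := exists_prefix_length_eq_cancel u⁻¹ w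
  rw [inv_inv] at hdu
  rw [← hc, ← hd]
  rcases le_total c.length d.length with h | h
  · rw [min_eq_left h]
    exact length_le_cancel hcx ((List.prefix_of_prefix_length_le hcw hdw h).trans hdu)
  · rw [min_eq_right h]
    exact length_le_cancel ((List.prefix_of_prefix_length_le hdw hcw h).trans hcx) hdu

/-- If `v` does not cancel the part of `u` which is cancelled by `g`, then multiplying `u` by `v`
does not increase the cancellation with `g`. -/
theorem cancel_mul_le {κ : Type*} [DecidableEq κ] {g u v : FreeGroup κ}
    (h : cancel g u + cancel u v < FreeGroup.norm u) : cancel g (u * v) ≤ cancel g u := by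
  have hmin := min_cancel_le_cancel g u (u * v)
  have huv := norm_mul_add_two_mul_cancel u v
  have hinv := norm_mul_add_two_mul_cancel u⁻¹ (u * v)
  rw [inv_mul_cancel_left, FreeGroup.norm_inv_eq] at hinv
  omega

theorem bLetter_not {ι : Type*} (p : ι × Bool) : bLetter (p.1, !p.2) = (bLetter p)⁻¹ := by
  obtain ⟨i, ε⟩ := p
  cases ε <;> simp [bLetter]

theorem mk_cons_eq_bLetter_mul {ι : Type*} (p : ι × Bool) (L : List (ι × Bool)) :
    FreeGroup.mk (p :: L) = bLetter p * FreeGroup.mk L := by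
  have : bLetter p = FreeGroup.mk [p] := by
    obtain ⟨i, ε⟩ := p
    cases ε <;> rfl
  rw [this, FreeGroup.mul_mk, List.singleton_append]

section Letters

variable {ι κ : Type*} [Fintype ι] [DecidableEq ι] [DecidableEq κ]

/-- The bound `P_χ` on left cancellation, extended to signed letters. -/
def letterPc (χ : FreeGroup ι →* FreeGroup κ) (p : ι × Bool) : ℕ :=
  cond p.2 (Pc χ p.1) (Sc χ p.1)

/-- The bound `S_χ` on right cancellation, extended to signed letters. -/
def letterSc (χ : FreeGroup ι →* FreeGroup κ) (p : ι × Bool) : ℕ :=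
  cond p.2 (Sc χ p.1) (Pc χ p.1)

theorem cancel_le_letterPc (χ : FreeGroup ι →* FreeGroup κ) {p q : ι × Bool}
    (h : p.1 = q.1 → p.2 = q.2) :
    cancel (χ (bLetter p)) (χ (bLetter q)) ≤ letterPc χ q := by
  obtain ⟨j, _ | _⟩ := q
  · have hq : χ (bLetter (j, false)) = (χ (FreeGroup.of j))⁻¹ := by simp [bLetter]
    rw [hq, ← inv_inv (χ (bLetter p)), cancel_inv_inv, ← map_inv, ← bLetter_not]
    refine Finset.le_sup (f := fun p => cancel (χ (FreeGroup.of j)) (χ (bLetter p))) ?_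
    obtain ⟨i, ε⟩ := p
    cases ε <;> simp_all
  · refine Finset.le_sup (f := fun p => cancel (χ (bLetter p)) (χ (FreeGroup.of j))) ?_
    obtain ⟨i, ε⟩ := p
    cases ε <;> simp_all

theorem cancel_le_letterSc (χ : FreeGroup ι →* FreeGroup κ) {p q : ι × Bool}
    (h : p.1 = q.1 → p.2 = q.2) :
    cancel (χ (bLetter p)) (χ (bLetter q)) ≤ letterSc χ p := by
  have := cancel_le_letterPc χ (p := (q.1, !q.2)) (q := (p.1, !p.2)) (by grind)
  rw [bLetter_not, bLetter_not, map_inv, map_inv, cancel_inv_inv] at this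
  obtain ⟨i, ε⟩ := p
  cases ε <;> exact this

theorem HasRemnant.letterPc_add_letterSc_lt {χ : FreeGroup ι →* FreeGroup κ} (h : HasRemnant χ)
    (p : ι × Bool) : letterPc χ p + letterSc χ p < FreeGroup.norm (χ (bLetter p)) := by
  obtain ⟨i, ε⟩ := p
  have := h i
  cases ε
  · simpa [letterPc, letterSc, bLetter, add_comm] using this
  · simpa [letterPc, letterSc, bLetter] using this

theorem HasRemnant.norm_bLetter {χ : FreeGroup ι →* FreeGroup κ} (h : HasRemnant χ)
    (p : ι × Bool) :
    FreeGroup.norm (χ (bLetter p)) = letterPc χ p + RemLen χ p.1 + letterSc χ p := by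
  obtain ⟨i, ε⟩ := p
  have := h i
  cases ε <;> simp [letterPc, letterSc, bLetter, RemLen] <;> omega

/-- In the image of a reduced word starting with `p`, at least the sum of the remnant lengths
survives to the right of the part of the image of `p` that a preceding letter can cancel. -/
theorem HasRemnant.cancel_le_and_le_norm {χ : FreeGroup ι →* FreeGroup κ} (hrem : HasRemnant χ)
    (L : List (ι × Bool)) : ∀ p, FreeGroup.IsReduced (p :: L) →
      (∀ g, cancel g (χ (bLetter p)) ≤ letterPc χ p →
        cancel g (χ (FreeGroup.mk (p :: L))) ≤ cancel g (χ (bLetter p))) ∧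
      letterPc χ p + ((p :: L).map fun q => RemLen χ q.1).sum ≤
        FreeGroup.norm (χ (FreeGroup.mk (p :: L))) := by
  induction L with
  | nil =>
    intro p _
    have hp := hrem.norm_bLetter p
    rw [mk_cons_eq_bLetter_mul, ← FreeGroup.one_eq_mk, mul_one]
    refine ⟨fun _ _ => le_rfl, ?_⟩
    simp only [List.map_cons, List.map_nil, List.sum_cons, List.sum_nil]
    omega
  | cons q L ih =>
    intro p h
    rw [FreeGroup.isReduced_cons_cons] at h
    obtain ⟨hpq, hL⟩ := h
    obtain ⟨ihc, ihn⟩ := ih q hL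
    have hP := cancel_le_letterPc χ hpq
    have hS := cancel_le_letterSc χ hpq
    have hc := ihc _ hP
    have hlt := hrem.letterPc_add_letterSc_lt p
    have hp := hrem.norm_bLetter p
    rw [mk_cons_eq_bLetter_mul p, map_mul]
    refine ⟨fun g hg => cancel_mul_le (by omega), ?_⟩
    have hn := norm_mul_add_two_mul_cancel (χ (bLetter p)) (χ (FreeGroup.mk (q :: L)))
    rw [List.map_cons, List.sum_cons]
    omega

end Letters

/-- If `φ : G → H` has remnant, then for every nontrivial `z ∈ G` with reduced expression
`z = a_{j₁}^{η₁} ⋯ a_{j_k}^{η_k}`, one has `|zφ| ≥ Σᵢ |Rem_φ(a_{jᵢ})|`. Here the reduced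
word of `z` is `z.toWord`, whose entries record the generators `a_{jᵢ}` and signs `ηᵢ`. -/
theorem norm_image_ge_sum_remnants {n : ℕ} {κ : Type*} [DecidableEq κ]
    (φ : FreeGroup (Fin n) →* FreeGroup κ) (hrem : HasRemnant φ)
    (z : FreeGroup (Fin n)) (hz : z ≠ 1) :
    (z.toWord.map fun p => RemLen φ p.1).sum ≤ FreeGroup.norm (φ z) := by
  cases hw : z.toWord with
  | nil => exact absurd (FreeGroup.toWord_eq_nil_iff.mp hw) hz
  | cons p L =>
    have h := (hrem.cancel_le_and_le_norm L p (hw ▸ FreeGroup.isReduced_toWord)).2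
    rw [← hw, FreeGroup.mk_toWord, hw] at h
    exact (Nat.le_add_left _ _).trans h
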